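/- arXiv:1703.02187 — 2 statements merged into one kernel-verified Lean document; each statement's English description precedes it below -/
import Mathlib

section
/- Let A, B, C be commutative groups, let i : A → B be an injective group homomorphism and j : B → C a group homomorphism with ker j ⊆ im i, let n be an integer, and let g : A → A and f : B → B be group homomorphisms such that f ∘ i = i ∘ g and j(f(b)) = n²·j(b) for all b ∈ B. Assume g(g(a)) = 0 for every a ∈ A with n·a = 0. Then f(f(f(x))) = 0 for every x ∈ B with n·x = 0. -/
/-- Second diagram chase: with `i` injective, `ker j ⊆ im i`, `f ∘ i = i ∘ g`,
`j ∘ f = n² • j`, and `g ∘ g` killing the `n`-torsion of `A`, the triple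
iterate of `f` kills the `n`-torsion of `B`. -/
theorem stmt_2 {A B C : Type*} [AddCommGroup A] [AddCommGroup B] [AddCommGroup C]
    (i : A →+ B) (hi : Function.Injective i)
    (j : B →+ C) (hker : ∀ b : B, j b = 0 → b ∈ Set.range i)
    (n : ℤ) (g : A →+ A) (f : B →+ B)
    (hfi : ∀ a : A, f (i a) = i (g a))
    (hfj : ∀ b : B, j (f b) = n ^ 2 • j b)
    (hg : ∀ a : A, n • a = 0 → g (g a) = 0) :
    ∀ x : B, n • x = 0 → f (f (f x)) = 0 := by
  intro x hx
  have hj : j (f x) = 0 := by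
    rw [hfj, ← map_zsmul, pow_two, mul_zsmul, hx, smul_zero, map_zero]
  obtain ⟨a, ha⟩ := hker (f x) hj
  have hna : n • a = 0 := by
    apply hi
    rw [map_zsmul, ha, ← map_zsmul, hx, map_zero, map_zero]
  rw [← ha, hfi, hfi, hg a hna, map_zero]
end

section
/- Let G be a commutative group, H ⊆ G a subgroup, and φ : G → G a group endomorphism that fixes every element of finite order of H. Let D ⊆ G be a finite subgroup such that φ(x) − x ∈ H for every x ∈ D. Then there exists a positive integer s such that φ^s(x) = x for all x ∈ D. -/
/-- If an additive endomorphism `φ` fixes `φ x - x`, then its iterates move `x` by multiples of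
`φ x - x`. -/
theorem AddMonoidHom.iterate_apply_eq_add_nsmul_of_map_sub_eq {G : Type*} [AddCommGroup G]
    (φ : G →+ G) {x : G} (hx : φ (φ x - x) = φ x - x) (n : ℕ) :
    (⇑φ)^[n] x = x + n • (φ x - x) := by
  induction n with
  | zero => simp
  | succ n ih =>
    rw [Function.iterate_succ_apply', ih, map_add, map_nsmul, hx, succ_nsmul]
    abel

/-- If `φ` fixes every finite-order element of the subgroup `H`, and `D` is a
finite subgroup with `φ x - x ∈ H` for all `x ∈ D`, then some positive iterate
of `φ` is the identity on `D`. -/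
theorem stmt_4 {G : Type*} [AddCommGroup G] (H : AddSubgroup G) (φ : G →+ G)
    (hφ : ∀ h ∈ H, IsOfFinAddOrder h → φ h = h)
    (D : AddSubgroup G) (hD : (D : Set G).Finite)
    (hDH : ∀ x ∈ D, φ x - x ∈ H) :
    ∃ s : ℕ, 0 < s ∧ ∀ x ∈ D, (⇑φ)^[s] x = x := by
  have : Finite D := hD
  refine ⟨Nat.card D, Nat.card_pos, fun x hx => ?_⟩
  have hcard : Nat.card D • x = 0 :=
    congrArg Subtype.val (card_nsmul_eq_zero' (x := (⟨x, hx⟩ : D)))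
  have hdiff : Nat.card D • (φ x - x) = 0 := by
    rw [nsmul_sub, ← map_nsmul, hcard, map_zero, sub_zero]
  have hfix : φ (φ x - x) = φ x - x :=
    hφ _ (hDH x hx) (isOfFinAddOrder_iff_nsmul_eq_zero.mpr ⟨_, Nat.card_pos, hdiff⟩)
  rw [φ.iterate_apply_eq_add_nsmul_of_map_sub_eq hfix, hdiff, add_zero]
end
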